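/- Let ω ∈ (0,1), let H be a separable infinite-dimensional Hilbert space, and let 𝔦 = ⟨(ω^{n−1})_{n=1}^∞⟩ be the principal Calkin space generated by the sequence (ω^{n−1})_{n=1}^∞. Then there exists A ∈ B(H) with s(A) ∈ 𝔦 such that the sequence (hₙ(M_{A,A}))_{n≥1} of Hilbert numbers of M_{A,A} : B(H) → B(H) does not belong to 𝔦; indeed, any compact A with sₙ(A) = ω^{n−1} for all n has this property. -/

import Mathlib

open scoped BigOperators

noncomputable section

/-- The space of complex null sequences `c₀`. -/
def c0 : Set (ℕ → ℂ) := {α | Filter.Tendsto α Filter.atTop (nhds 0)}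

/-- `rearrSum α n` is the supremum of `∑_{i ∈ F} |α i|` over finite sets `F ⊆ ℕ` with
`|F| = n`; for a null sequence it equals `α*₁ + ⋯ + α*ₙ` where `α*` is the decreasing
rearrangement of `(|α_n|)`. -/
def rearrSum (α : ℕ → ℂ) (n : ℕ) : ℝ :=
  sSup ((fun F : Finset ℕ => ∑ i ∈ F, ‖α i‖) '' {F | F.card = n})

/-- The decreasing rearrangement of a null sequence, 0-indexed:
`rearr α n = α*_{n+1}`. -/
def rearr (α : ℕ → ℂ) (n : ℕ) : ℝ := rearrSum α (n + 1) - rearrSum α n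

/-- A Calkin space: a linear subspace of `c₀` containing every null sequence whose
decreasing rearrangement is dominated termwise by that of one of its members. -/
def IsCalkinSpace (I : Set (ℕ → ℂ)) : Prop :=
  I ⊆ c0 ∧ (0 : ℕ → ℂ) ∈ I ∧
  (∀ α ∈ I, ∀ β ∈ I, α + β ∈ I) ∧
  (∀ (c : ℂ), ∀ α ∈ I, c • α ∈ I) ∧
  (∀ α ∈ I, ∀ β ∈ c0, (∀ n, rearr β n ≤ rearr α n) → β ∈ I)

/-- `tensorSum α β n` is the supremum of `∑_{(i,j) ∈ F} |α i| |β j|` over finite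
`F ⊆ ℕ × ℕ` with `|F| = n`; it equals `(α⊗β)₁ + ⋯ + (α⊗β)ₙ`. -/
def tensorSum (α β : ℕ → ℂ) (n : ℕ) : ℝ :=
  sSup ((fun F : Finset (ℕ × ℕ) => ∑ p ∈ F, ‖α p.1‖ * ‖β p.2‖) '' {F | F.card = n})

/-- The tensor sequence `α⊗β`: the decreasing rearrangement of the double sequence
`(|α_m β_n|)_{m,n}`, 0-indexed: `tensorSeq α β n = (α⊗β)_{n+1}`. -/
def tensorSeq (α β : ℕ → ℂ) (n : ℕ) : ℝ := tensorSum α β (n + 1) - tensorSum α β n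

/-- Embedding of real sequences into complex sequences. -/
def toC (f : ℕ → ℝ) : ℕ → ℂ := fun n => (f n : ℂ)

/-- The tensor product `𝔦⊗𝔧` of two Calkin spaces: the smallest Calkin space
containing `α⊗β` for all `α ∈ 𝔦`, `β ∈ 𝔧`. -/
def calkinTensor (I J : Set (ℕ → ℂ)) : Set (ℕ → ℂ) :=
  ⋂₀ {K | IsCalkinSpace K ∧ ∀ α ∈ I, ∀ β ∈ J, toC (tensorSeq α β) ∈ K}

/-- A Calkin space `𝔦` is stable if `𝔦⊗𝔦 = 𝔦`. -/
def IsStableCalkin (I : Set (ℕ → ℂ)) : Prop := IsCalkinSpace I ∧ calkinTensor I I = I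

/-- The principal Calkin space `⟨α⟩` generated by `α`: the smallest Calkin space
containing `α`. -/
def principalCalkin (α : ℕ → ℂ) : Set (ℕ → ℂ) := ⋂₀ {K | IsCalkinSpace K ∧ α ∈ K}

/-- `Kw ω α n = #{m : ω^{n+1} < α m ≤ ω^n}` (the sequence `α` being 0-indexed). -/
def Kw (ω : ℝ) (α : ℕ → ℝ) (n : ℕ) : ℕ :=
  Set.ncard {m : ℕ | ω ^ (n + 1) < α m ∧ α m ≤ ω ^ n}

/-- `K̃ₙ = Σ_{i=0}^n Kᵢ`. -/
def Ktil (ω : ℝ) (α : ℕ → ℝ) (n : ℕ) : ℕ := ∑ i ∈ Finset.range (n + 1), Kw ω α i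

/-- `Mₙ = Σ_{i+j=n} Kᵢ Kⱼ`. -/
def Mw (ω : ℝ) (α : ℕ → ℝ) (n : ℕ) : ℕ :=
  ∑ i ∈ Finset.range (n + 1), Kw ω α i * Kw ω α (n - i)

/-- `M̃ₙ = Σ_{i=0}^n Mᵢ`. -/
def Mtil (ω : ℝ) (α : ℕ → ℝ) (n : ℕ) : ℕ := ∑ i ∈ Finset.range (n + 1), Mw ω α i

/-- The `n`-th approximation number of `T` (1-indexed: `approxNum T n = aₙ(T)` is the
infimum of `‖T - F‖` over bounded operators `F` of rank `< n`).  For operators between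
Hilbert spaces this equals the `n`-th singular number. -/
def approxNum {X Y : Type*} [NormedAddCommGroup X] [NormedSpace ℂ X]
    [NormedAddCommGroup Y] [NormedSpace ℂ Y] (T : X →L[ℂ] Y) (n : ℕ) : ℝ :=
  sInf {c | ∃ F : X →L[ℂ] Y, LinearMap.rank (F : X →ₗ[ℂ] Y) < (n : Cardinal) ∧ c = ‖T - F‖}

/-- The `n`-th Kolmogorov number `dₙ(T)` (1-indexed). -/
def kolNum {X Y : Type*} [NormedAddCommGroup X] [NormedSpace ℂ X]
    [NormedAddCommGroup Y] [NormedSpace ℂ Y] (T : X →L[ℂ] Y) (n : ℕ) : ℝ :=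
  sInf {c | ∃ V : Submodule ℂ Y, Module.rank ℂ V < (n : Cardinal) ∧
    c = ⨆ x : {x : X // ‖x‖ ≤ 1}, ⨅ y : V, ‖T x.1 - (y : Y)‖}

/-- The `n`-th Hilbert number `hₙ(T)` (1-indexed): the supremum of `sₙ(A ∘ T ∘ B)` over
all Hilbert spaces `K`, `H'` and all contractions `B : K → X`, `A : Y → H'`. -/
def hilbertNum {X Y : Type u} [NormedAddCommGroup X] [NormedSpace ℂ X]
    [NormedAddCommGroup Y] [NormedSpace ℂ Y] (T : X →L[ℂ] Y) (n : ℕ) : ℝ :=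
  sSup {c | ∃ (K : Type u) (_ : NormedAddCommGroup K) (_ : InnerProductSpace ℂ K)
    (_ : CompleteSpace K) (H' : Type u) (_ : NormedAddCommGroup H')
    (_ : InnerProductSpace ℂ H') (_ : CompleteSpace H')
    (B : K →L[ℂ] X) (A : Y →L[ℂ] H'), ‖B‖ ≤ 1 ∧ ‖A‖ ≤ 1 ∧
    c = approxNum ((A.comp T).comp B) n}

/-- The sequence of singular numbers of an operator, 0-indexed:
`sSeq T n = s_{n+1}(T) = a_{n+1}(T)`. -/
def sSeq {X Y : Type*} [NormedAddCommGroup X] [NormedSpace ℂ X]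
    [NormedAddCommGroup Y] [NormedSpace ℂ Y] (T : X →L[ℂ] Y) : ℕ → ℝ :=
  fun n => approxNum T (n + 1)

/-- The multiplication operator `M_{a,b} : x ↦ a * x * b` on a normed algebra. -/
def Mop {A : Type*} [NonUnitalNormedRing A] [NormedSpace ℂ A] [IsScalarTower ℂ A A]
    [SMulCommClass ℂ A A] (a b : A) : A →L[ℂ] A :=
  (ContinuousLinearMap.mul ℂ A a).comp ((ContinuousLinearMap.mul ℂ A).flip b)

/-! ### A Calkin space of exponentially decaying sequences -/

/-- Null sequences with at most linearly many entries above `ω ^ m`. -/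
def expSpace (ω : ℝ) : Set (ℕ → ℂ) :=
  {α | α ∈ c0 ∧ ∃ C : ℕ, ∀ m : ℕ, ∀ F : Finset ℕ, (∀ i ∈ F, ω ^ m < ‖α i‖) →
    F.card ≤ C * (m + 1)}

lemma rearr_bddAbove {α : ℕ → ℂ} (hα : α ∈ c0) (n : ℕ) :
    BddAbove ((fun F : Finset ℕ => ∑ i ∈ F, ‖α i‖) '' {F | F.card = n}) := by
  have h : Filter.Tendsto (fun i => ‖α i‖) Filter.atTop (nhds 0) := by
    have h0 : Filter.Tendsto α Filter.atTop (nhds 0) := hα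
    simpa using h0.norm
  obtain ⟨M, hM⟩ := h.bddAbove_range
  refine ⟨n * M, ?_⟩
  rintro _ ⟨F, hF, rfl⟩
  have hF' : F.card = n := hF
  have := Finset.sum_le_card_nsmul F (fun i => ‖α i‖) M (fun i _ => hM ⟨i, rfl⟩)
  simpa [hF'] using this

lemma rearr_nonempty (α : ℕ → ℂ) (n : ℕ) :
    ((fun F : Finset ℕ => ∑ i ∈ F, ‖α i‖) '' {F | F.card = n}).Nonempty :=
  ⟨_, Finset.range n, by simp, rfl⟩

lemma rearr_le_of {α : ℕ → ℂ} (hα : α ∈ c0) (n : ℕ) (t : ℝ)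
    (h : ∀ F : Finset ℕ, F.card = n + 1 → ∃ i ∈ F, ‖α i‖ ≤ t) : rearr α n ≤ t := by
  have : rearrSum α (n + 1) ≤ rearrSum α n + t := by
    refine csSup_le (rearr_nonempty α (n + 1)) ?_
    rintro _ ⟨F, hF, rfl⟩
    obtain ⟨i, hi, hit⟩ := h F hF
    have hF' : F.card = n + 1 := hF
    have h1 : ∑ j ∈ F.erase i, ‖α j‖ ≤ rearrSum α n :=
      le_csSup (rearr_bddAbove hα n) ⟨F.erase i, by simp [Finset.card_erase_of_mem hi, hF'], rfl⟩
    have h2 := Finset.sum_erase_add F (fun j => ‖α j‖) hi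
    simp only at h2 ⊢
    linarith
  unfold rearr
  linarith

lemma le_rearr_of {α : ℕ → ℂ} (hα : α ∈ c0) (n : ℕ) (t : ℝ) (G : Finset ℕ)
    (hG : G.card = n + 1) (h : ∀ i ∈ G, t ≤ ‖α i‖) : t ≤ rearr α n := by
  have : rearrSum α n ≤ rearrSum α (n + 1) - t := by
    refine csSup_le (rearr_nonempty α n) ?_
    rintro _ ⟨F, hF, rfl⟩
    have hF' : F.card = n := hF
    obtain ⟨i, hi, hiF⟩ := Finset.exists_mem_notMem_of_card_lt_card (s := F) (t := G) (by omega)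
    have h1 : ∑ j ∈ insert i F, ‖α j‖ ≤ rearrSum α (n + 1) :=
      le_csSup (rearr_bddAbove hα (n + 1))
        ⟨insert i F, by simp [Finset.card_insert_of_notMem hiF, hF'], rfl⟩
    rw [Finset.sum_insert hiF] at h1
    have := h i hi
    simp only
    linarith
  unfold rearr
  linarith

lemma expSpace_isCalkin {ω : ℝ} (h0 : 0 < ω) (h1 : ω < 1) : IsCalkinSpace (expSpace ω) := by
  refine ⟨fun α h => h.1, ⟨?_, 0, ?_⟩, ?_, ?_, ?_⟩
  · exact tendsto_const_nhds
  · intro m F hF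
    have : F = ∅ := by
      refine Finset.eq_empty_of_forall_notMem fun i hi => ?_
      have := hF i hi
      have := pow_pos h0 m
      simp at *
      linarith
    simp [this]
  · rintro α ⟨hα, C, hC⟩ β ⟨hβ, D, hD⟩
    refine ⟨?_, ?_⟩
    · have := Filter.Tendsto.add (show Filter.Tendsto α _ _ from hα)
        (show Filter.Tendsto β _ _ from hβ)
      rw [add_zero] at this
      exact this
    · obtain ⟨j, hj⟩ := exists_pow_lt_of_lt_one (show (0:ℝ) < 1/2 by norm_num) h1
      refine ⟨(C + D) * (j + 1), fun m F hF => ?_⟩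
      classical
      have e1 := hC (m + j) (F.filter fun i => ω ^ (m + j) < ‖α i‖) (by simp)
      have e2 := hD (m + j) (F.filter fun i => ω ^ (m + j) < ‖β i‖) (by simp)
      have e3 : F ⊆ (F.filter fun i => ω ^ (m + j) < ‖α i‖) ∪
          (F.filter fun i => ω ^ (m + j) < ‖β i‖) := by
        intro i hi
        by_contra hcon
        simp only [Finset.mem_union, Finset.mem_filter, hi, true_and, not_or, not_lt] at hcon
        have := hF i hi
        have h3 : ‖(α + β) i‖ ≤ ‖α i‖ + ‖β i‖ := norm_add_le _ _
        have h4 : ω ^ (m + j) ≤ ω ^ m * (1/2) := by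
          rw [pow_add]
          exact mul_le_mul_of_nonneg_left hj.le (pow_pos h0 m).le
        linarith [hcon.1, hcon.2]
      have e4 := (Finset.card_le_card e3).trans (Finset.card_union_le _ _)
      have e5 : m + j + 1 ≤ (j + 1) * (m + 1) := by nlinarith [Nat.zero_le (j * m)]
      calc F.card ≤ C * (m + j + 1) + D * (m + j + 1) := by omega
        _ = (C + D) * (m + j + 1) := by ring
        _ ≤ (C + D) * ((j + 1) * (m + 1)) := Nat.mul_le_mul_left _ e5
        _ = _ := by ring
  · rintro c α ⟨hα, C, hC⟩
    refine ⟨?_, ?_⟩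
    · have := Filter.Tendsto.const_smul (show Filter.Tendsto α _ _ from hα) c
      rw [smul_zero] at this
      exact this
    · obtain ⟨j, hj⟩ := exists_pow_lt_of_lt_one
        (show (0:ℝ) < 1/(‖c‖ + 1) by positivity) h1
      refine ⟨C * (j + 1), fun m F hF => ?_⟩
      have e1 := hC (m + j) F (by
        intro i hi
        have := hF i hi
        have h2 : ‖(c • α) i‖ = ‖c‖ * ‖α i‖ := by simp
        rw [h2] at this
        by_contra hcon
        push Not at hcon
        rw [lt_div_iff₀ (by positivity)] at hj
        have h5 : ‖c‖ * ‖α i‖ ≤ (‖c‖ + 1) * ω ^ (m + j) := by gcongr; linarith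
        have h6 : (‖c‖ + 1) * ω ^ (m + j) ≤ ω ^ m := by
          rw [pow_add]
          nlinarith [pow_pos h0 m]
        linarith)
      have e5 : m + j + 1 ≤ (j + 1) * (m + 1) := by nlinarith [Nat.zero_le (j * m)]
      calc F.card ≤ C * (m + j + 1) := e1
        _ ≤ C * ((j + 1) * (m + 1)) := Nat.mul_le_mul_left _ e5
        _ = _ := by ring
  · rintro α ⟨hα, C, hC⟩ β hβ hle
    refine ⟨hβ, 2 * C, fun m F hF => ?_⟩
    rcases Nat.eq_zero_or_pos F.card with h | h
    · omega
    obtain ⟨n, hn⟩ : ∃ n, F.card = n + 1 := ⟨F.card - 1, by omega⟩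
    by_contra hcon
    have e1 := le_rearr_of hβ n (ω ^ m) F hn (fun i hi => (hF i hi).le)
    have e2 : rearr α n ≤ ω ^ (m + 1) := by
      refine rearr_le_of hα n _ fun G hG => ?_
      by_contra! hno
      have := hC (m + 1) G hno
      nlinarith
    have e3 : ω ^ (m + 1) < ω ^ m := pow_lt_pow_right_of_lt_one₀ h0 h1 (by omega)
    linarith [hle n]

lemma geom_mem_expSpace {ω : ℝ} (h0 : 0 < ω) (h1 : ω < 1) :
    (toC fun n => ω ^ n) ∈ expSpace ω := by
  refine ⟨?_, 1, fun m F hF => ?_⟩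
  · have := (tendsto_pow_atTop_nhds_zero_of_lt_one h0.le h1)
    have h2 := (Complex.continuous_ofReal.tendsto 0).comp this
    rw [Complex.ofReal_zero] at h2
    exact h2
  · have : F ⊆ Finset.range m := by
      intro i hi
      have := hF i hi
      simp only [toC, Complex.norm_real, Real.norm_eq_abs, abs_of_pos (pow_pos h0 i)] at this
      rw [pow_lt_pow_iff_right_of_lt_one₀ h0 h1] at this
      simpa using this
    have := Finset.card_le_card this
    simp at this
    omega

lemma not_mem_principal {ω : ℝ} (h0 : 0 < ω) (h1 : ω < 1) (f : ℕ → ℝ)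
    (hf : ∀ m n : ℕ, n < (m + 1) ^ 2 → ω ^ (4 * m) / (16 * (m + 1 : ℝ) ^ 4) ≤ f n) :
    toC f ∉ principalCalkin (toC fun n => ω ^ n) := by
  intro hmem
  obtain ⟨-, C, hC⟩ := hmem (expSpace ω) ⟨expSpace_isCalkin h0 h1, geom_mem_expSpace h0 h1⟩
  obtain ⟨M, hM⟩ := (tendsto_pow_const_mul_const_pow_of_lt_one 4 h0.le h1).bddAbove_range
  have hM' : ∀ m : ℕ, (m + 1 : ℝ) ^ 4 * ω ^ (m + 1) ≤ M := fun m => by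
    have := hM ⟨m + 1, rfl⟩
    simpa using this
  have hMpos : 0 < M := lt_of_lt_of_le (by positivity) (hM' 0)
  obtain ⟨p, hp⟩ := exists_pow_lt_of_lt_one (show (0:ℝ) < 1 / (16 * M) by positivity) h1
  have key : ∀ m : ℕ, (m + 1) ^ 2 ≤ C * (5 * m + 1 + p + 1) := by
    intro m
    have := hC (5 * m + 1 + p) (Finset.range ((m + 1) ^ 2)) (by
      intro i hi
      have hi' := hf m i (by simpa using hi)
      have : ‖toC f i‖ = |f i| := by simp [toC]
      rw [this]
      refine lt_of_lt_of_le ?_ (hi'.trans (le_abs_self _))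
      rw [lt_div_iff₀ (by positivity)]
      rw [lt_div_iff₀ (by positivity)] at hp
      have e : ω ^ (5 * m + 1 + p) * (16 * (m + 1 : ℝ) ^ 4) =
        ω ^ (4 * m) * (ω ^ p * (16 * ((m + 1 : ℝ) ^ 4 * ω ^ (m + 1)))) := by ring
      rw [e]
      have e2 : ω ^ p * (16 * ((m + 1 : ℝ) ^ 4 * ω ^ (m + 1))) ≤ ω ^ p * (16 * M) := by
        gcongr
        exact hM' m
      have := pow_pos h0 (4 * m)
      nlinarith)
    simpa using this
  have h := key (C * (p + 7))
  have e : C * (5 * (C * (p + 7)) + 1 + p + 1) ≤ (C * (p + 7)) * (C * (p + 7) + 1) := by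
    have h2 : 5 * (C * (p + 7)) + 1 + p + 1 ≤ (p + 7) * (C * (p + 7) + 1) := by
      nlinarith [Nat.zero_le (p * (C * (p+7))), Nat.zero_le (C * (p+7))]
    calc _ ≤ C * ((p + 7) * (C * (p + 7) + 1)) := Nat.mul_le_mul_left _ h2
      _ = _ := by ring
  nlinarith

/-! ### Approximation numbers -/

section approx
variable {X Y : Type*} [NormedAddCommGroup X] [NormedSpace ℂ X]
    [NormedAddCommGroup Y] [NormedSpace ℂ Y]

lemma approxNum_bddBelow (T : X →L[ℂ] Y) (n : ℕ) :
    BddBelow {c | ∃ F : X →L[ℂ] Y, LinearMap.rank (F : X →ₗ[ℂ] Y) < (n : Cardinal) ∧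
      c = ‖T - F‖} :=
  ⟨0, by rintro _ ⟨F, -, rfl⟩; exact norm_nonneg _⟩

lemma approxNum_le (T F : X →L[ℂ] Y) (n : ℕ)
    (hF : LinearMap.rank (F : X →ₗ[ℂ] Y) < (n : Cardinal)) : approxNum T n ≤ ‖T - F‖ :=
  csInf_le (approxNum_bddBelow T n) ⟨F, hF, rfl⟩

lemma approxNum_le_norm (T : X →L[ℂ] Y) (n : ℕ) : approxNum T (n + 1) ≤ ‖T‖ := by
  have := approxNum_le T 0 (n + 1) (by simp)
  simpa using this

lemma norm_le_approxNum_one (T : X →L[ℂ] Y) : ‖T‖ ≤ approxNum T 1 := by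
  refine le_csInf ⟨_, 0, by simp, rfl⟩ ?_
  rintro _ ⟨F, hF, rfl⟩
  have h0 : LinearMap.rank (F : X →ₗ[ℂ] Y) = 0 := by
    rw [Nat.cast_one] at hF
    exact Cardinal.lt_one_iff.mp hF
  have h1 : (F : X →ₗ[ℂ] Y) = 0 := by
    rw [LinearMap.rank, rank_zero_iff_forall_zero] at h0
    ext x
    have := h0 ⟨(F : X →ₗ[ℂ] Y) x, ⟨x, rfl⟩⟩
    simpa using congrArg Subtype.val this
  have h2 : F = 0 := by
    ext x
    exact LinearMap.congr_fun h1 x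
  simp [h2]

lemma le_approxNum (T : X →L[ℂ] Y) (n : ℕ) (c : ℝ) (V : Submodule ℂ X) [FiniteDimensional ℂ V]
    (hV : n + 1 ≤ Module.finrank ℂ V) (h : ∀ x ∈ V, c * ‖x‖ ≤ ‖T x‖) :
    c ≤ approxNum T (n + 1) := by
  refine le_csInf ⟨_, 0, by simp, rfl⟩ ?_
  rintro _ ⟨F, hF, rfl⟩
  set G : V →ₗ[ℂ] Y := (F : X →ₗ[ℂ] Y).comp V.subtype with hG
  have h1 : LinearMap.rank G < ((n + 1 : ℕ) : Cardinal) :=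
    (LinearMap.rank_comp_le_left _ _).trans_lt hF
  have h2 : Module.finrank ℂ (LinearMap.range G) < n + 1 := by
    have : (Module.finrank ℂ (LinearMap.range G) : Cardinal) < ((n + 1 : ℕ) : Cardinal) := by
      rw [Module.finrank_eq_rank]
      exact h1
    exact_mod_cast this
  have h3 := LinearMap.finrank_range_add_finrank_ker G
  have h4 : 0 < Module.finrank ℂ (LinearMap.ker G) := by omega
  have := Module.finrank_pos_iff.mp h4
  obtain ⟨⟨x, hx⟩, hx0⟩ := exists_ne (0 : LinearMap.ker G)
  have hx1 : F (x : X) = 0 := hx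
  have hx2 : (x : X) ≠ 0 := by
    intro hh
    apply hx0
    ext
    exact hh
  have h5 := (T - F).le_opNorm (x : X)
  have h6 : (T - F) (x : X) = T x := by simp [hx1]
  rw [h6] at h5
  exact le_of_mul_le_mul_right ((h x x.2).trans h5) (norm_pos_iff.mpr hx2)

end approx

universe v

lemma le_hilbertNum {X Y : Type v} [NormedAddCommGroup X] [NormedSpace ℂ X]
    [NormedAddCommGroup Y] [NormedSpace ℂ Y] (T : X →L[ℂ] Y) (n : ℕ)
    {K H' : Type v} [NormedAddCommGroup K] [InnerProductSpace ℂ K] [CompleteSpace K]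
    [NormedAddCommGroup H'] [InnerProductSpace ℂ H'] [CompleteSpace H']
    (B : K →L[ℂ] X) (A : Y →L[ℂ] H') (hB : ‖B‖ ≤ 1) (hA : ‖A‖ ≤ 1) :
    approxNum ((A.comp T).comp B) (n + 1) ≤ hilbertNum T (n + 1) := by
  refine le_csSup ⟨‖T‖, ?_⟩ ⟨K, _, _, inferInstance, H', _, _, inferInstance, B, A, hB, hA, rfl⟩
  rintro _ ⟨K, _, _, _, H', _, _, _, B, A, hB, hA, rfl⟩
  refine (approxNum_le_norm _ n).trans ?_
  calc ‖(A.comp T).comp B‖ ≤ ‖A.comp T‖ * ‖B‖ := ContinuousLinearMap.opNorm_comp_le _ _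
    _ ≤ (‖A‖ * ‖T‖) * ‖B‖ := by gcongr; exact ContinuousLinearMap.opNorm_comp_le _ _
    _ ≤ (1 * ‖T‖) * 1 := by gcongr
    _ = ‖T‖ := by ring

section greedy
variable {H : Type v} [NormedAddCommGroup H] [InnerProductSpace ℂ H] [CompleteSpace H]

lemma greedy_step (A : H →L[ℂ] H) (m k : ℕ) (hk : k ≤ m) (t : ℝ) (ht : t < approxNum A (m + 1))
    (ht0 : 0 ≤ t) (u : ℕ → H) :
    ∃ y : H, ‖y‖ ≤ 1 ∧ t ≤ ‖A y‖ ∧ ∀ j < k, inner ℂ (A (u j)) (A y) = 0 := by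
  let W : Submodule ℂ H := Submodule.span ℂ
    (Set.range fun j : Fin k => ContinuousLinearMap.adjoint A (A (u j)))
  have : FiniteDimensional ℂ W := FiniteDimensional.span_of_finite ℂ (Set.finite_range _)
  have hW : Module.finrank ℂ W ≤ k := by
    have := finrank_range_le_card (R := ℂ)
      (fun j : Fin k => ContinuousLinearMap.adjoint A (A (u j)))
    simpa [Set.finrank] using this
  let F : H →L[ℂ] H := A.comp W.starProjection
  have hF : LinearMap.rank (F : H →ₗ[ℂ] H) < ((m + 1 : ℕ) : Cardinal) := by
    have e : (F : H →ₗ[ℂ] H) = (A : H →ₗ[ℂ] H).comp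
        (W.subtype.comp (W.orthogonalProjectionOnto : H →ₗ[ℂ] W)) := by
      ext x
      rfl
    rw [e]
    refine (LinearMap.rank_comp_le_right _ _).trans_lt ?_
    refine (LinearMap.rank_comp_le_left _ _).trans_lt ?_
    refine (LinearMap.rank_le_domain _).trans_lt ?_
    rw [← Module.finrank_eq_rank]
    exact_mod_cast (by omega : Module.finrank ℂ W < m + 1)
  have h1 : t < ‖A - F‖ := ht.trans_le (approxNum_le A F _ hF)
  obtain ⟨z, hz, hz2⟩ := ContinuousLinearMap.exists_lt_apply_of_lt_opNorm (A - F) h1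
  refine ⟨z - W.starProjection z, ?_, ?_, ?_⟩
  · have := Submodule.norm_sq_eq_add_norm_sq_starProjection z W
    rw [Submodule.starProjection_orthogonal_val] at this
    nlinarith [norm_nonneg z, norm_nonneg (z - W.starProjection z),
      sq_nonneg ‖W.starProjection z‖]
  · have : A (z - W.starProjection z) = (A - F) z := by simp [F]
    rw [this]
    exact hz2.le
  · intro j hj
    rw [← ContinuousLinearMap.adjoint_inner_left]
    exact W.sub_starProjection_mem_orthogonal z _ (Submodule.subset_span ⟨⟨j, hj⟩, rfl⟩)

lemma greedy (A : H →L[ℂ] H) (m : ℕ) (t : ℝ) (ht : t < approxNum A (m + 1))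
    (ht0 : 0 ≤ t) (k : ℕ) (hk : k ≤ m + 1) :
    ∃ u : ℕ → H, (∀ i < k, ‖u i‖ ≤ 1 ∧ t ≤ ‖A (u i)‖) ∧
      ∀ i < k, ∀ j < k, i ≠ j → inner ℂ (A (u i)) (A (u j)) = 0 := by
  induction k with
  | zero => exact ⟨0, by simp, by simp⟩
  | succ k ih =>
    obtain ⟨u, hu, huo⟩ := ih (by omega)
    obtain ⟨y, hy1, hy2, hy3⟩ := greedy_step A m k (by omega) t ht ht0 u
    refine ⟨Function.update u k y, ?_, ?_⟩
    · intro i hi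
      rcases Nat.lt_succ_iff_lt_or_eq.mp hi with h | rfl
      · rw [Function.update_of_ne h.ne]
        exact hu i h
      · simp [hy1, hy2]
    · intro i hi j hj hij
      rcases Nat.lt_succ_iff_lt_or_eq.mp hi with h | rfl
      · rcases Nat.lt_succ_iff_lt_or_eq.mp hj with h' | rfl
        · rw [Function.update_of_ne h.ne, Function.update_of_ne h'.ne]
          exact huo i h j h' hij
        · rw [Function.update_of_ne h.ne, Function.update_self]
          exact hy3 i h
      · have h' : j < i := by omega
        rw [Function.update_of_ne h'.ne, Function.update_self, inner_eq_zero_symm]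
        exact hy3 j h'

end greedy

section lower
variable {H : Type v} [NormedAddCommGroup H] [InnerProductSpace ℂ H] [CompleteSpace H]

lemma Mop_apply' (A X : H →L[ℂ] H) (z : H) : Mop A A X z = A (X (A z)) := rfl

lemma hilbertNum_lower (A : H →L[ℂ] H) (hA : ‖A‖ ≤ 1) (m : ℕ) (t : ℝ) (ht0 : 0 ≤ t)
    (ht : t < approxNum A (m + 1)) (n : ℕ) (hn : n < (m + 1) ^ 2) :
    t ^ 4 / (m + 1 : ℝ) ^ 4 ≤ hilbertNum (Mop A A) (n + 1) := by
  classical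
  obtain ⟨u, hu, huo⟩ := greedy A m t ht ht0 (m + 1) le_rfl
  let ι : Type v := ULift (Fin (m + 1) × Fin (m + 1))
  let N : ℝ := (m + 1 : ℝ) ^ 2
  have hN : 0 < N := by positivity
  have hcard : (Fintype.card ι : ℝ) = N := by simp [ι, N]; ring
  let a : ι → H := fun p => u p.down.1
  let b : ι → H := fun p => u p.down.2
  have ha : ∀ p, ‖a p‖ ≤ 1 := fun p => (hu _ p.down.1.2).1
  have hb : ∀ p, ‖b p‖ ≤ 1 := fun p => (hu _ p.down.2.2).1
  have hAu : ∀ x : H, ‖x‖ ≤ 1 → ‖A x‖ ≤ 1 := fun x hx =>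
    (A.le_opNorm x).trans (mul_le_one₀ hA (norm_nonneg _) hx)
  let E := EuclideanSpace ℂ ι
  let c : ℂ := ((N⁻¹ : ℝ) : ℂ)
  have hc : ‖c‖ = N⁻¹ := by simp [c, abs_of_pos hN]
  let B : E →L[ℂ] (H →L[ℂ] H) := ∑ p : ι, c • (EuclideanSpace.proj p : E →L[ℂ] ℂ).smulRight
    (InnerProductSpace.rankOne ℂ (a p) (A (b p)))
  let A' : (H →L[ℂ] H) →L[ℂ] E := ∑ p : ι, c •
    ((innerSL ℂ (A (a p))).comp (ContinuousLinearMap.apply ℂ H (b p))).smulRight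
      (EuclideanSpace.single p (1 : ℂ))
  have hsum : ∀ {Z : Type v} [NormedAddCommGroup Z] (f : ι → Z), (∀ p, ‖f p‖ ≤ N⁻¹) →
      ‖∑ p, f p‖ ≤ 1 := by
    intro Z _ f hf
    calc ‖∑ p, f p‖ ≤ ∑ p : ι, N⁻¹ := norm_sum_le_of_le _ fun p _ => hf p
      _ = 1 := by
        rw [Finset.sum_const, Finset.card_univ, nsmul_eq_mul, hcard, mul_inv_cancel₀ hN.ne']
  have hproj : ∀ p : ι, ‖(EuclideanSpace.proj p : E →L[ℂ] ℂ)‖ ≤ 1 := fun p =>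
    ContinuousLinearMap.opNorm_le_bound _ zero_le_one fun x => by
      rw [one_mul]
      exact PiLp.norm_apply_le x p
  have hB : ‖B‖ ≤ 1 := by
    refine hsum _ fun p => ?_
    rw [norm_smul, hc, ContinuousLinearMap.norm_smulRight_apply, InnerProductSpace.norm_rankOne]
    refine mul_le_of_le_one_right (by positivity) ?_
    exact mul_le_one₀ (hproj p) (by positivity)
      (mul_le_one₀ (ha p) (by positivity) (hAu _ (hb p)))
  have hA' : ‖A'‖ ≤ 1 := by
    refine hsum _ fun p => ?_
    rw [norm_smul, hc, ContinuousLinearMap.norm_smulRight_apply]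
    refine mul_le_of_le_one_right (by positivity) ?_
    have e1 : ‖(EuclideanSpace.single p (1 : ℂ) : E)‖ = 1 := by simp
    rw [e1, mul_one]
    refine ContinuousLinearMap.opNorm_le_bound _ zero_le_one fun Y => ?_
    rw [one_mul]
    simp only [ContinuousLinearMap.comp_apply, ContinuousLinearMap.apply_apply,
      innerSL_apply_apply]
    calc ‖inner ℂ (A (a p)) (Y (b p))‖ ≤ ‖A (a p)‖ * ‖Y (b p)‖ := norm_inner_le_norm _ _
      _ ≤ 1 * (‖Y‖ * 1) := by
        gcongr
        · exact hAu _ (ha p)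
        · exact (Y.le_opNorm _).trans (by gcongr; exact hb p)
      _ = ‖Y‖ := by ring
  refine le_trans ?_ (le_hilbertNum (Mop A A) n B A' hB hA')
  have hdiag : ∀ (x : E) (p : ι), ((A'.comp (Mop A A)).comp B) x p =
      c * c * ((‖A (a p)‖ : ℂ) ^ 2 * (‖A (b p)‖ : ℂ) ^ 2) * x p := by
    intro x p
    have e1 : ∀ q : ι, q ≠ p → inner ℂ (A (b q)) (A (b p)) * inner ℂ (A (a p)) (A (a q)) = 0 := by
      intro q hq
      by_cases h1 : q.down.1 = p.down.1
      · have h2 : q.down.2 ≠ p.down.2 := fun h2 => hq (ULift.ext _ _ (Prod.ext h1 h2))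
        have : inner ℂ (A (b q)) (A (b p)) = 0 :=
          huo _ q.down.2.2 _ p.down.2.2 (fun h => h2 (Fin.ext h))
        rw [this, zero_mul]
      · have : inner ℂ (A (a p)) (A (a q)) = 0 :=
          huo _ p.down.1.2 _ q.down.1.2 (fun h => h1 (Fin.ext h.symm))
        rw [this, mul_zero]
    have e2 : ((A'.comp (Mop A A)).comp B) x p = c * inner ℂ (A (a p)) (A (B x (A (b p)))) := by
      simp only [ContinuousLinearMap.comp_apply, A', sum_apply,
        smul_apply, ContinuousLinearMap.smulRight_apply,
        ContinuousLinearMap.apply_apply, innerSL_apply_apply, Mop_apply']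
      simp [E, Pi.single_apply]
      refine (Finset.sum_eq_single p (fun q _ hq => if_neg hq.symm) (by simp)).trans (if_pos rfl)
    have e3 : B x (A (b p)) = ∑ q, (c * x q * inner ℂ (A (b q)) (A (b p))) • a q := by
      simp only [B, sum_apply, smul_apply, ContinuousLinearMap.smulRight_apply,
        InnerProductSpace.rankOne_apply, smul_smul, mul_assoc]
      rfl
    rw [e2, e3, map_sum, inner_sum, Finset.sum_eq_single p]
    · rw [map_smul, inner_smul_right, inner_self_eq_norm_sq_to_K, inner_self_eq_norm_sq_to_K]
      simp only [Complex.coe_algebraMap]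
      ring
    · intro q _ hq
      rw [map_smul, inner_smul_right, mul_assoc, e1 q hq, mul_zero]
    · simp
  have hfr : Module.finrank ℂ (⊤ : Submodule ℂ E) = (m + 1) ^ 2 := by
    rw [finrank_top]
    simp [E, ι]
    ring
  refine le_approxNum _ n _ ⊤ (by omega) fun x _ => ?_
  have hcoef : ∀ p : ι, t ^ 4 / (m + 1 : ℝ) ^ 4 * ‖x p‖ ≤
      ‖((A'.comp (Mop A A)).comp B) x p‖ := by
    intro p
    rw [hdiag, norm_mul]
    gcongr
    rw [norm_mul, norm_mul, hc, norm_mul, norm_pow, norm_pow, Complex.norm_real, Complex.norm_real,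
      norm_norm, norm_norm]
    have h1 : t ≤ ‖A (a p)‖ := (hu _ p.down.1.2).2
    have h2 : t ≤ ‖A (b p)‖ := (hu _ p.down.2.2).2
    calc t ^ 4 / (m + 1 : ℝ) ^ 4 = N⁻¹ * N⁻¹ * (t ^ 2 * t ^ 2) := by
          simp only [N]
          field_simp
      _ ≤ _ := by gcongr
  rw [EuclideanSpace.norm_eq, EuclideanSpace.norm_eq]
  have hK : 0 ≤ t ^ 4 / (m + 1 : ℝ) ^ 4 := by positivity
  rw [← Real.sqrt_sq hK, ← Real.sqrt_mul (by positivity), Finset.mul_sum]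
  refine Real.sqrt_le_sqrt (Finset.sum_le_sum fun p _ => ?_)
  rw [← mul_pow]
  exact pow_le_pow_left₀ (by positivity) (hcoef p) 2

lemma main_any (ω : ℝ) (h0 : 0 < ω) (h1 : ω < 1) (A : H →L[ℂ] H)
    (hs : ∀ n, sSeq A n = ω ^ n) :
    toC (sSeq A) ∈ principalCalkin (toC fun n => ω ^ n) ∧
        toC (fun n => hilbertNum (Mop A A) (n + 1)) ∉
          principalCalkin (toC fun n => ω ^ n) := by
  constructor
  · have : sSeq A = fun n => ω ^ n := funext hs
    rw [this]
    rintro K ⟨-, hK⟩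
    exact hK
  · refine not_mem_principal h0 h1 _ fun m n hn => ?_
    have hA : ‖A‖ ≤ 1 := (norm_le_approxNum_one A).trans (by
      have := hs 0
      simp only [sSeq, pow_zero, zero_add] at this
      exact this.le)
    have hm : approxNum A (m + 1) = ω ^ m := hs m
    have hp := pow_pos h0 m
    refine le_trans (le_of_eq ?_)
      (hilbertNum_lower A hA m (ω ^ m / 2) (by positivity) (by rw [hm]; linarith) n hn)
    field_simp
    ring

end lower

section diag
variable {H : Type v} [NormedAddCommGroup H] [InnerProductSpace ℂ H] [CompleteSpace H]

lemma exists_orthonormal_seq (hinf : ¬ FiniteDimensional ℂ H) :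
    ∃ e : ℕ → H, Orthonormal ℂ e := by
  obtain ⟨w, b, hb⟩ := exists_hilbertBasis ℂ H
  have hw : Infinite w := by
    by_contra hfin
    rw [not_infinite_iff_finite] at hfin
    have := Fintype.ofFinite w
    exact hinf (b.toOrthonormalBasis.toBasis.finiteDimensional_of_finite)
  exact ⟨_, b.orthonormal.comp _ (Infinite.natEmbedding w).injective⟩

lemma orthonormal_sum_norm_sq {e : ℕ → H} (he : Orthonormal ℂ e) (s : Finset ℕ) (l : ℕ → ℂ) :
    ‖∑ i ∈ s, l i • e i‖ ^ 2 = ∑ i ∈ s, ‖l i‖ ^ 2 := by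
  have h := he.inner_sum l l s
  rw [inner_self_eq_norm_sq_to_K] at h
  have h2 : ((‖∑ i ∈ s, l i • e i‖ ^ 2 : ℝ) : ℂ) = ((∑ i ∈ s, ‖l i‖ ^ 2 : ℝ) : ℂ) := by
    push_cast
    refine h.trans ?_
    refine Finset.sum_congr rfl fun i _ => ?_
    exact Complex.conj_mul' (l i)
  exact_mod_cast h2

lemma exists_diag (hinf : ¬ FiniteDimensional ℂ H) (ω : ℝ) (h0 : 0 < ω) (h1 : ω < 1) :
    ∃ A : H →L[ℂ] H, IsCompactOperator ⇑A ∧ ∀ n, sSeq A n = ω ^ n := by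
  obtain ⟨e, he⟩ := exists_orthonormal_seq hinf
  let R : ℕ → (H →L[ℂ] H) := fun n => ((ω ^ n : ℝ) : ℂ) • InnerProductSpace.rankOne ℂ (e n) (e n)
  have hR : ∀ n, ‖R n‖ = ω ^ n := fun n => by
    simp [R, norm_smul, he.1 n, abs_of_pos h0]
  have hRx : ∀ n x, R n x = (((ω ^ n : ℝ) : ℂ) * inner ℂ (e n) x) • e n := fun n x => by
    simp only [R, smul_apply, InnerProductSpace.rankOne_apply, smul_smul]
  have hsumm : Summable R := by
    refine Summable.of_norm ?_
    simp only [hR]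
    exact summable_geometric_of_lt_one h0.le h1
  let S : ℕ → (H →L[ℂ] H) := fun n => ∑ i ∈ Finset.range n, R i
  have hlim : Filter.Tendsto S Filter.atTop (nhds (∑' n, R n)) := hsumm.hasSum.tendsto_sum_nat
  have hrank1 : ∀ n, LinearMap.rank (R n : H →ₗ[ℂ] H) ≤ 1 := by
    intro n
    have e1 : (R n : H →ₗ[ℂ] H) = (LinearMap.toSpanSingleton ℂ H (e n)).comp
        ((((ω ^ n : ℝ) : ℂ) • innerSL ℂ (e n) : H →L[ℂ] ℂ) : H →ₗ[ℂ] ℂ) := by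
      ext x
      simp [hRx]
    rw [e1]
    refine (LinearMap.rank_comp_le_left _ _).trans ?_
    rw [LinearMap.rank, LinearMap.range_toSpanSingleton]
    exact (rank_span_le _).trans (by simp)
  have hrank : ∀ n, LinearMap.rank (S n : H →ₗ[ℂ] H) ≤ n := by
    intro n
    induction n with
    | zero => simp [S]
    | succ n ih =>
      have e1 : (S (n + 1) : H →ₗ[ℂ] H) = (S n : H →ₗ[ℂ] H) + (R n : H →ₗ[ℂ] H) := by
        ext x
        simp [S, Finset.sum_range_succ]
      rw [e1]
      refine (LinearMap.rank_add_le _ _).trans ?_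
      push_cast
      exact add_le_add ih (hrank1 n)
  have hcomp : ∀ n, IsCompactOperator ⇑(S n) := by
    intro n
    refine Submodule.sum_mem (compactOperator (RingHom.id ℂ) H H) fun i _ => ?_
    refine Submodule.smul_mem _ _ ?_
    rw [InnerProductSpace.rankOne_def']
    exact (isCompactOperator_of_locallyCompactSpace_rng
      (ContinuousLinearMap.toSpanSingleton ℂ (e i))).comp_clm (innerSL ℂ (e i))
  refine ⟨∑' n, R n, isCompactOperator_of_tendsto hlim (Filter.Eventually.of_forall hcomp), ?_⟩
  intro n
  refine le_antisymm ?_ ?_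
  · refine (approxNum_le _ (S n) (n + 1) ((hrank n).trans_lt (by exact_mod_cast Nat.lt_succ_self n))).trans ?_
    have hlim2 : Filter.Tendsto (fun k => ‖S k - S n‖) Filter.atTop (nhds ‖∑' n, R n - S n‖) :=
      (hlim.sub_const _).norm
    refine le_of_tendsto hlim2 (Filter.eventually_atTop.mpr ⟨n, fun k hk => ?_⟩)
    refine ContinuousLinearMap.opNorm_le_bound _ (by positivity) fun x => ?_
    have e1 : (S k - S n) x = ∑ i ∈ Finset.Ico n k, (((ω ^ i : ℝ) : ℂ) * inner ℂ (e i) x) • e i := by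
      have : S k - S n = ∑ i ∈ Finset.Ico n k, R i := (Finset.sum_Ico_eq_sub R hk).symm
      rw [this, sum_apply]
      exact Finset.sum_congr rfl fun i _ => hRx i x
    refine abs_le_of_sq_le_sq' ?_ (by positivity) |>.2
    rw [e1, orthonormal_sum_norm_sq he, mul_pow]
    calc ∑ i ∈ Finset.Ico n k, ‖((ω ^ i : ℝ) : ℂ) * inner ℂ (e i) x‖ ^ 2
        ≤ ∑ i ∈ Finset.Ico n k, (ω ^ n) ^ 2 * ‖inner ℂ (e i) x‖ ^ 2 := by
          refine Finset.sum_le_sum fun i hi => ?_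
          rw [norm_mul, mul_pow, Complex.norm_real, Real.norm_eq_abs, abs_of_pos (pow_pos h0 i)]
          have : ω ^ i ≤ ω ^ n := pow_le_pow_of_le_one h0.le h1.le (Finset.mem_Ico.mp hi).1
          gcongr
      _ = (ω ^ n) ^ 2 * ∑ i ∈ Finset.Ico n k, ‖inner ℂ (e i) x‖ ^ 2 := by rw [Finset.mul_sum]
      _ ≤ (ω ^ n) ^ 2 * ‖x‖ ^ 2 := by
          gcongr
          exact he.sum_inner_products_le x
  · let f : Fin (n + 1) → H := fun i => e i
    have hf : Orthonormal ℂ f := he.comp _ Fin.val_injective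
    have : FiniteDimensional ℂ (Submodule.span ℂ (Set.range f)) :=
      FiniteDimensional.span_of_finite ℂ (Set.finite_range _)
    refine le_approxNum _ n _ (Submodule.span ℂ (Set.range f)) ?_ ?_
    · rw [finrank_span_eq_card hf.linearIndependent]
      simp
    · intro x hx
      obtain ⟨l, hl⟩ := (Submodule.mem_span_range_iff_exists_fun ℂ).mp hx
      let l' : ℕ → ℂ := fun i => if h : i < n + 1 then l ⟨i, h⟩ else 0
      have hx' : x = ∑ i ∈ Finset.range (n + 1), l' i • e i := by
        rw [← hl, Finset.sum_range]
        refine Finset.sum_congr rfl fun i _ => ?_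
        simp only [l', f, i.2, dif_pos]
      have hAe : ∀ i, (∑' n, R n) (e i) = ((ω ^ i : ℝ) : ℂ) • e i := by
        intro i
        have h2 : HasSum (fun n => R n (e i)) ((∑' n, R n) (e i)) :=
          hsumm.hasSum.mapL (ContinuousLinearMap.apply ℂ H (e i))
        refine h2.unique ?_
        have h3 := hasSum_single (f := fun n => R n (e i)) i (fun k hk => by
          simp only [hRx]
          rw [he.2 hk, mul_zero, zero_smul])
        convert h3 using 1
        rw [hRx, inner_self_eq_norm_sq_to_K, he.1 i]
        simp
      have hAx : (∑' n, R n) x = ∑ i ∈ Finset.range (n + 1), (l' i * ((ω ^ i : ℝ) : ℂ)) • e i := by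
        rw [hx', map_sum]
        refine Finset.sum_congr rfl fun i _ => ?_
        rw [map_smul, hAe, smul_smul]
      refine abs_le_of_sq_le_sq' ?_ (by positivity) |>.2
      rw [hAx, mul_pow, orthonormal_sum_norm_sq he, hx', orthonormal_sum_norm_sq he,
        Finset.mul_sum]
      refine Finset.sum_le_sum fun i hi => ?_
      rw [norm_mul, mul_pow, Complex.norm_real, Real.norm_eq_abs, abs_of_pos (pow_pos h0 i),
        mul_comm]
      have : ω ^ n ≤ ω ^ i := pow_le_pow_of_le_one h0.le h1.le
        (Nat.lt_succ_iff.mp (Finset.mem_range.mp hi))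
      gcongr

end diag

/-- Let `ω ∈ (0,1)`, `H` a separable infinite-dimensional Hilbert
space and `𝔦 = ⟨(ω^{n-1})ₙ⟩` the principal Calkin space generated by `(ω^{n-1})ₙ`.
Then there is `A ∈ B(H)` with `s(A) ∈ 𝔦` and `(hₙ(M_{A,A}))ₙ ∉ 𝔦`; indeed any compact
`A` with `sₙ(A) = ω^{n-1}` for all `n` has this property. -/
theorem exists_symbol_in_hilbertNum_not_in {H : Type u} [NormedAddCommGroup H]
    [InnerProductSpace ℂ H] [CompleteSpace H] [TopologicalSpace.SeparableSpace H]
    (hinf : ¬ FiniteDimensional ℂ H)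
    (ω : ℝ) (hω : ω ∈ Set.Ioo (0 : ℝ) 1) :
    (∃ A : H →L[ℂ] H, IsCompactOperator ⇑A ∧
        toC (sSeq A) ∈ principalCalkin (toC fun n => ω ^ n) ∧
        toC (fun n => hilbertNum (Mop A A) (n + 1)) ∉
          principalCalkin (toC fun n => ω ^ n)) ∧
    (∀ A : H →L[ℂ] H, IsCompactOperator ⇑A → (∀ n, sSeq A n = ω ^ n) →
        toC (sSeq A) ∈ principalCalkin (toC fun n => ω ^ n) ∧
        toC (fun n => hilbertNum (Mop A A) (n + 1)) ∉
          principalCalkin (toC fun n => ω ^ n)) := by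
  obtain ⟨h0, h1⟩ := hω
  refine ⟨?_, fun A _ hs => main_any ω h0 h1 A hs⟩
  obtain ⟨A, hA, hs⟩ := exists_diag hinf ω h0 h1
  exact ⟨A, hA, main_any ω h0 h1 A hs⟩
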